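/- Let u and v be unit vectors in ℂ² that are linearly independent and not orthogonal (⟨u, v⟩ ≠ 0). Let e = ℂu and f = ℂv be the corresponding one-dimensional subspaces, with orthoprojectors E = P_u and F = P_v. Then e ∨ f = ℂ² (E and F are complementary: E ∨ F = I), e ∧ f = {0} (E and F are incompatible: E ∧ F = 0), but EF ≠ 0 (E and F are not contradictory) and E + F ≠ I (they are not orthocomplementary). Hence there exist complementary incompatible pairs of quantum events which are not contradictory, which is impossible for classical (Boolean) events. -/

import Mathlib

open scoped ComplexInnerProductSpace

/-- **Complementary incompatible but non-contradictory quantum events (Bohr complementarity).**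
For unit vectors `u`, `v` of `ℂ²` which are linearly independent but not orthogonal, the
one-dimensional subspaces `e = ℂu`, `f = ℂv` with orthoprojectors `E = P_u = ⟪u, ·⟫ u` and
`F = P_v = ⟪v, ·⟫ v` satisfy: `e ∨ f = ℂ²` (complementary), `e ∧ f = {0}` (incompatible),
yet `EF ≠ 0` (not contradictory) and `E + F ≠ I` (not orthocomplementary). -/
theorem complementary_incompatible_not_contradictory
    (u v : EuclideanSpace ℂ (Fin 2)) (hu : ‖u‖ = 1) (hv : ‖v‖ = 1)
    (hind : LinearIndependent ℂ ![u, v]) (hno : ⟪u, v⟫ ≠ 0) :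
    Submodule.span ℂ {u} ⊔ Submodule.span ℂ {v} = ⊤
    ∧ Submodule.span ℂ {u} ⊓ Submodule.span ℂ {v} = ⊥
    ∧ ((innerSL ℂ u).smulRight u) ∘L ((innerSL ℂ v).smulRight v) ≠ 0
    ∧ ((innerSL ℂ u).smulRight u) + ((innerSL ℂ v).smulRight v) ≠ 1 := by
  have hu0 : u ≠ 0 := hind.ne_zero 0
  have hv0 : v ≠ 0 := hind.ne_zero 1
  refine ⟨?_, ?_, fun h => ?_, fun h => ?_⟩
  · have hspan := hind.span_eq_top_of_card_eq_finrank (by simp)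
    rw [← Submodule.span_union, Set.singleton_union]
    simpa [Set.pair_comm v u] using hspan
  · rw [← disjoint_iff, Submodule.disjoint_span_singleton' hv0]
    intro hmem
    obtain ⟨a, ha⟩ := Submodule.mem_span_singleton.mp hmem
    exact (LinearIndependent.pair_iff' hu0).mp hind a ha
  · have hEF := congrArg (fun T => T v) h
    simp [hv, hno, hu0] at hEF
  · have hsum := congrArg (fun T => T u) h
    have hvu : ⟪v, u⟫ ≠ 0 := fun h0 => hno (inner_eq_zero_symm.mp h0)
    simp [hu, hvu, hv0] at hsum
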